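/- arXiv:2102.13620 — 3 statements merged into one kernel-verified Lean document; each statement's English description precedes it below -/
import Mathlib

section
/- For every real x ≥ 0 and every real β > 1, the Gaussian tail integral satisfies ∫_{x}^{∞} exp(-t²) dt ≥ (√π / 2) · √(2e/π) · (√(β - 1) / β) · exp(-β x²). -/
open Real MeasureTheory

/-- The supremum of `y * exp (-y²)` over the reals is at most `1 / √(2e)`. -/
lemma sqrt_two_mul_exp_one_mul_le_exp_sq (y : ℝ) :
    Real.sqrt (2 * Real.exp 1) * y ≤ Real.exp (y ^ 2) := by
  refine le_of_sq_le_sq ?_ (Real.exp_pos _).le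
  have h := Real.add_one_le_exp (2 * y ^ 2 - 1)
  rw [mul_pow, Real.sq_sqrt (by positivity), ← Real.exp_nat_mul]
  calc 2 * Real.exp 1 * y ^ 2 = Real.exp 1 * (2 * y ^ 2 - 1 + 1) := by ring
    _ ≤ Real.exp 1 * Real.exp (2 * y ^ 2 - 1) := by gcongr
    _ = Real.exp ((2 : ℕ) * y ^ 2) := by
      rw [← Real.exp_add]; push_cast; ring_nf

lemma integral_Ioi_mul_exp_neg_mul_sq {b : ℝ} (hb : 0 < b) (x : ℝ) :
    ∫ t in Set.Ioi x, t * Real.exp (-b * t ^ 2) = Real.exp (-b * x ^ 2) / (2 * b) := by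
  have hderiv : ∀ t ∈ Set.Ici x, HasDerivAt (fun t => -(Real.exp (-b * t ^ 2) / (2 * b)))
      (t * Real.exp (-b * t ^ 2)) t := by
    intro t _
    refine (((hasDerivAt_pow 2 t).const_mul (-b)).exp.div_const (2 * b)).neg.congr_deriv ?_
    push_cast
    field_simp
  have hlim : Filter.Tendsto (fun t : ℝ => -(Real.exp (-b * t ^ 2) / (2 * b)))
      Filter.atTop (nhds 0) := by
    have h : Filter.Tendsto (fun t : ℝ => -b * t ^ 2) Filter.atTop Filter.atBot :=
      (Filter.tendsto_pow_atTop two_ne_zero).const_mul_atTop_of_neg (neg_neg_of_pos hb)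
    simpa using ((Real.tendsto_exp_atBot.comp h).div_const (2 * b)).neg
  rw [integral_Ioi_of_hasDerivAt_of_tendsto' hderiv
    (integrable_mul_exp_neg_mul_sq hb).integrableOn hlim]
  ring

/-- Chernoff-type lower bound on the Gaussian tail (Chang et al.):
for `x ≥ 0` and `β > 1`,
`∫_{x}^{∞} exp (-t²) dt ≥ (√π / 2) · √(2e/π) · (√(β - 1) / β) · exp (-β x²)`. -/
theorem gaussian_tail_lower_bound (x : ℝ) (hx : 0 ≤ x) (β : ℝ) (hβ : 1 < β) :
    Real.sqrt π / 2 * Real.sqrt (2 * Real.exp 1 / π) * (Real.sqrt (β - 1) / β) *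
        Real.exp (-β * x ^ 2)
      ≤ ∫ t in Set.Ioi x, Real.exp (-t ^ 2) := by
  have hβ0 : 0 < β := by linarith
  have hconst : Real.sqrt π / 2 * Real.sqrt (2 * Real.exp 1 / π) =
      Real.sqrt (2 * Real.exp 1) / 2 := by
    have : Real.sqrt π ≠ 0 := (Real.sqrt_pos.2 Real.pi_pos).ne'
    rw [Real.sqrt_div (by positivity)]
    field_simp
  have hpt (t : ℝ) : Real.sqrt (2 * Real.exp 1) * Real.sqrt (β - 1) *
      (t * Real.exp (-β * t ^ 2)) ≤ Real.exp (-t ^ 2) := by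
    have h := sqrt_two_mul_exp_one_mul_le_exp_sq (Real.sqrt (β - 1) * t)
    rw [mul_pow, Real.sq_sqrt (by linarith)] at h
    calc _ = Real.sqrt (2 * Real.exp 1) * (Real.sqrt (β - 1) * t) * Real.exp (-β * t ^ 2) := by
          ring
      _ ≤ Real.exp ((β - 1) * t ^ 2) * Real.exp (-β * t ^ 2) := by gcongr
      _ = Real.exp (-t ^ 2) := by rw [← Real.exp_add]; ring_nf
  calc _ = Real.sqrt (2 * Real.exp 1) * Real.sqrt (β - 1) *
        ∫ t in Set.Ioi x, t * Real.exp (-β * t ^ 2) := by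
        rw [integral_Ioi_mul_exp_neg_mul_sq hβ0, hconst]
        field_simp
    _ = ∫ t in Set.Ioi x, Real.sqrt (2 * Real.exp 1) * Real.sqrt (β - 1) *
        (t * Real.exp (-β * t ^ 2)) := (integral_const_mul _ _).symm
    _ ≤ ∫ t in Set.Ioi x, Real.exp (-t ^ 2) := by
        refine setIntegral_mono
          ((integrable_mul_exp_neg_mul_sq hβ0).const_mul _).integrableOn ?_ hpt
        simpa using (integrable_exp_neg_mul_sq one_pos).integrableOn
end

section
/- Let μ be the standard Gaussian measure N(0, 1) on ℝ. Then for every real m ≥ 0 and every real β > 1, μ{z : z ≥ m} ≥ (1/2) · √(2e/π) · (√(β - 1) / β) · exp(-β m² / 2). -/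
open Real MeasureTheory ProbabilityTheory

/-- The derivative of `-exp (-β x² / 2)`, suitably normalized, is dominated by the standard
Gaussian density. -/
lemma mul_exp_le_gaussianPDFReal {β : ℝ} (hβ : 1 < β) (x : ℝ) :
    (√(2 * π))⁻¹ * exp (1 / 2) * √(β - 1) * (x * exp (-β * x ^ 2 / 2))
      ≤ gaussianPDFReal 0 1 x := by
  have hs : √(β - 1) ^ 2 = β - 1 := Real.sq_sqrt (by linarith)
  have ht : √(β - 1) * x ≤ exp (((√(β - 1) * x) ^ 2 - 1) / 2) := by
    nlinarith [add_one_le_exp (((√(β - 1) * x) ^ 2 - 1) / 2), sq_nonneg (√(β - 1) * x - 1)]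
  have hexp : exp (((√(β - 1) * x) ^ 2 - 1) / 2) * (exp (1 / 2) * exp (-β * x ^ 2 / 2))
      = exp (-x ^ 2 / 2) := by
    rw [← exp_add, ← exp_add, mul_pow, hs]
    congr 1
    ring
  have key : √(β - 1) * x * (exp (1 / 2) * exp (-β * x ^ 2 / 2)) ≤ exp (-x ^ 2 / 2) :=
    hexp ▸ mul_le_mul_of_nonneg_right ht (by positivity)
  calc _ = (√(2 * π))⁻¹ * (√(β - 1) * x * (exp (1 / 2) * exp (-β * x ^ 2 / 2))) := by ring
    _ ≤ (√(2 * π))⁻¹ * exp (-x ^ 2 / 2) := by gcongr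
    _ = gaussianPDFReal 0 1 x := by simp [gaussianPDFReal]

lemma half_mul_sqrt_two_mul_exp_one_div_pi :
    1 / 2 * √(2 * exp 1 / π) = (√(2 * π))⁻¹ * exp (1 / 2) := by
  have h : 2 * exp 1 / π = (2 * ((√(2 * π))⁻¹ * exp (1 / 2))) ^ 2 := by
    rw [mul_pow, mul_pow, inv_pow, Real.sq_sqrt (by positivity), ← exp_nat_mul]
    norm_num
    field_simp
    norm_num
  rw [h, Real.sqrt_sq (by positivity)]
  ring

/-- Lower bound on the upper tail of the standard Gaussian: for `m ≥ 0` and `β > 1`,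
`N(0,1) {z : z ≥ m} ≥ (1/2) √(2e/π) (√(β-1)/β) exp (-β m² / 2)`. -/
theorem std_gaussian_tail_lower_bound (m : ℝ) (hm : 0 ≤ m) (β : ℝ) (hβ : 1 < β) :
    ENNReal.ofReal
        ((1 / 2) * Real.sqrt (2 * Real.exp 1 / π) * (Real.sqrt (β - 1) / β) *
          Real.exp (-β * m ^ 2 / 2))
      ≤ gaussianReal 0 1 {z | m ≤ z} := by
  have hβ0 : 0 < β := by linarith
  rw [gaussianReal_apply_eq_integral 0 one_ne_zero, half_mul_sqrt_two_mul_exp_one_div_pi]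
  refine ENNReal.ofReal_le_ofReal ?_
  change _ ≤ ∫ x in Set.Ici m, gaussianPDFReal 0 1 x
  rw [integral_Ici_eq_integral_Ioi]
  set c := (√(2 * π))⁻¹ * exp (1 / 2) * √(β - 1) with hc
  have hderiv : ∀ x ∈ Set.Ici m, HasDerivAt (fun y ↦ -(c / β) * exp (-β * y ^ 2 / 2))
      (c * (x * exp (-β * x ^ 2 / 2))) x := by
    intro x _
    have h := ((((hasDerivAt_pow 2 x).const_mul (-β)).div_const 2).exp).const_mul (-(c / β))
    refine h.congr_deriv ?_
    push_cast
    field_simp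
  have hpos : ∀ x ∈ Set.Ioi m, 0 ≤ c * (x * exp (-β * x ^ 2 / 2)) := by
    intro x hx
    have : 0 ≤ x := hm.trans (le_of_lt hx)
    positivity
  have hlim : Filter.Tendsto (fun y ↦ -(c / β) * exp (-β * y ^ 2 / 2)) Filter.atTop (nhds 0) := by
    have h : Filter.Tendsto (fun y : ℝ ↦ -β * y ^ 2 / 2) Filter.atTop Filter.atBot :=
      ((Filter.tendsto_pow_atTop two_ne_zero).const_mul_atTop_of_neg
        (neg_lt_zero.mpr hβ0)).atBot_div_const two_pos
    simpa using (tendsto_exp_atBot.comp h).const_mul (-(c / β))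
  calc _ = ∫ x in Set.Ioi m, c * (x * exp (-β * x ^ 2 / 2)) := by
        rw [integral_Ioi_of_hasDerivAt_of_nonneg' hderiv hpos hlim, hc]
        ring
    _ ≤ _ := setIntegral_mono_on (integrableOn_Ioi_deriv_of_nonneg' hderiv hpos hlim)
        (integrable_gaussianPDFReal 0 1).integrableOn measurableSet_Ioi
        fun x _ ↦ mul_exp_le_gaussianPDFReal hβ x
end

section
/- Let μ be the real Gaussian measure N(m, σ²) with mean m ≥ 0 and variance σ² > 0. Then for every real β > 1, μ{z : z ≤ 0} ≥ (1/2) · √(2e/π) · (√(β - 1) / β) · exp(-β m² / (2σ²)). -/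
open Real MeasureTheory ProbabilityTheory

/-- Normalized form of `x * exp (-(β - 1) x² / 2) ≤ exp (-1/2) / √(β - 1)`. -/
lemma sqrt_sub_one_mul_exp_le (β s : ℝ) (hβ : 1 ≤ β) :
    (1 / 2) * √(2 * exp 1 / π) * (√(β - 1) * s) * exp (-β * s ^ 2 / 2)
      ≤ (√(2 * π))⁻¹ * exp (-s ^ 2 / 2) := by
  have hconst : (1 / 2) * √(2 * exp 1 / π) = (√(2 * π))⁻¹ * exp (1 / 2) := by
    have h : 2 * exp 1 / π = (2 * ((√(2 * π))⁻¹ * exp (1 / 2))) ^ 2 := by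
      have h1 : exp 1 = exp (1 / 2) ^ 2 := by rw [← exp_nat_mul]; norm_num
      rw [mul_pow, mul_pow, inv_pow, sq_sqrt (by positivity), ← h1]
      field_simp
    rw [h, sqrt_sq (by positivity)]
    ring
  have hroot : √(β - 1) * s ≤ exp (((β - 1) * s ^ 2 - 1) / 2) := by
    refine (le_abs_self _).trans (abs_le_of_sq_le_sq ?_ (exp_pos _).le)
    rw [mul_pow, sq_sqrt (by linarith), ← exp_nat_mul]
    have := add_one_le_exp ((β - 1) * s ^ 2 - 1)
    rw [sub_add_cancel] at this
    refine this.trans_eq ?_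
    congr 1
    push_cast
    ring
  calc (1 / 2) * √(2 * exp 1 / π) * (√(β - 1) * s) * exp (-β * s ^ 2 / 2)
      ≤ (√(2 * π))⁻¹ * exp (1 / 2) * exp (((β - 1) * s ^ 2 - 1) / 2)
          * exp (-β * s ^ 2 / 2) := by
        rw [hconst]
        gcongr
    _ = (√(2 * π))⁻¹ * exp (-s ^ 2 / 2) := by
        rw [mul_assoc, mul_assoc, ← exp_add, ← exp_add]
        ring_nf

/-- Lower bound on the lower tail of a Gaussian `N(m, σ²)` with `m ≥ 0`, `σ² > 0`:
for `β > 1`, `N(m, σ²) {z : z ≤ 0} ≥ (1/2) √(2e/π) (√(β-1)/β) exp (-β m² / (2σ²))`. -/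
theorem gaussian_lower_tail_lower_bound (m : ℝ) (hm : 0 ≤ m) (σ : ℝ) (hσ : 0 < σ)
    (β : ℝ) (hβ : 1 < β) :
    ENNReal.ofReal
        ((1 / 2) * Real.sqrt (2 * Real.exp 1 / π) * (Real.sqrt (β - 1) / β) *
          Real.exp (-β * m ^ 2 / (2 * σ ^ 2)))
      ≤ gaussianReal m (Real.toNNReal (σ ^ 2)) {z | z ≤ 0} := by
  have hβ0 : 0 < β := by linarith
  have hv : (σ ^ 2).toNNReal ≠ 0 := (Real.toNNReal_pos.mpr (by positivity)).ne'
  rw [gaussianReal_apply_eq_integral m hv]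
  apply ENNReal.ofReal_le_ofReal
  set C := (1 / 2) * √(2 * exp 1 / π) * (√(β - 1) / β) with hC
  have hC0 : 0 ≤ C := by positivity
  let F : ℝ → ℝ := fun z ↦ C * exp (-β * (m - z) ^ 2 / (2 * σ ^ 2))
  let F' : ℝ → ℝ := fun z ↦ C * (exp (-β * (m - z) ^ 2 / (2 * σ ^ 2)) * (β * (m - z) / σ ^ 2))
  have hderiv (z : ℝ) : HasDerivAt F (F' z) z := by
    refine (HasDerivAt.exp ?_).const_mul C
    refine (((((hasDerivAt_id z).const_sub m).pow 2).const_mul (-β)).div_const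
      (2 * σ ^ 2)).congr_deriv ?_
    simp
    field_simp
  have hbound (z : ℝ) : F' z ≤ gaussianPDFReal m (σ ^ 2).toNNReal z := by
    have h := sqrt_sub_one_mul_exp_le β ((m - z) / σ) hβ.le
    have h2 := mul_le_mul_of_nonneg_left h (inv_nonneg.mpr hσ.le)
    rw [gaussianPDFReal_def, Real.coe_toNNReal _ (sq_nonneg σ), sqrt_mul (by positivity),
      sqrt_sq hσ.le]
    refine (Eq.le ?_).trans (h2.trans_eq ?_)
    · simp only [F', hC, div_pow]
      rw [show -β * ((m - z) ^ 2 / σ ^ 2) / 2 = -β * (m - z) ^ 2 / (2 * σ ^ 2) by field_simp]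
      field_simp
    · rw [show -((m - z) / σ) ^ 2 / 2 = -(z - m) ^ 2 / (2 * σ ^ 2) by field_simp; ring]
      field_simp
  have hnonneg {z : ℝ} (hz : z ≤ 0) : 0 ≤ F' z := by
    have : 0 ≤ m - z := by linarith
    positivity
  have hpdf := (integrable_gaussianPDFReal m (σ ^ 2).toNNReal).integrableOn (s := Set.Iic 0)
  have hint : IntegrableOn F' (Set.Iic 0) := by
    refine hpdf.mono' (by fun_prop) ?_
    filter_upwards [ae_restrict_mem measurableSet_Iic] with z hz
    rw [norm_of_nonneg (hnonneg hz)]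
    exact hbound z
  have hlim : Filter.Tendsto F Filter.atBot (nhds 0) := by
    rw [← mul_zero C]
    refine (tendsto_exp_atBot.comp ?_).const_mul C
    have h1 : Filter.Tendsto (fun z : ℝ ↦ (m - z) ^ 2) Filter.atBot Filter.atTop :=
      (Filter.tendsto_pow_atTop two_ne_zero).comp
        (Filter.tendsto_atTop_add_const_left _ m Filter.tendsto_neg_atBot_atTop)
    exact (h1.const_mul_atTop_of_neg (neg_neg_of_pos hβ0)).atBot_div_const (by positivity)
  have hFTC := integral_Iic_of_hasDerivAt_of_tendsto' (fun z _ ↦ hderiv z) hint hlim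
  calc C * exp (-β * m ^ 2 / (2 * σ ^ 2)) = ∫ z in Set.Iic 0, F' z := by
        rw [hFTC]
        simp [F]
    _ ≤ _ := setIntegral_mono hint hpdf hbound
end
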